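/- arXiv:1507.05056 — 2 statements merged into one kernel-verified Lean document; each statement's English description precedes it below -/
import Mathlib

section
/- Let A be a symmetric real n×n matrix. If the quadratic form x ↦ xᵀAx is not definite (neither positive definite nor negative definite), then the skew-characteristic polynomial is not sign-definite: there exist skew-symmetric real n×n matrices Λ₁ and Λ₂ with det(A − Λ₁) ≤ 0 and det(A − Λ₂) ≥ 0. -/
open Matrix

/-- A real quadratic form taking a nonpositive and a nonnegative value at nonzero vectors has a
nonzero isotropic vector. -/
theorem exists_isotropic_of_nonpos_of_nonneg {ι : Type*} [Fintype ι] (A : Matrix ι ι ℝ)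
    {u v : ι → ℝ} (hu : u ≠ 0) (hv : v ≠ 0) (hAu : u ⬝ᵥ (A *ᵥ u) ≤ 0)
    (hAv : 0 ≤ v ⬝ᵥ (A *ᵥ v)) :
    ∃ x : ι → ℝ, x ≠ 0 ∧ x ⬝ᵥ (A *ᵥ x) = 0 := by
  let γ : ℝ → ι → ℝ := fun t => (1 - t) • u + t • v
  have hγ : Continuous γ := by fun_prop
  have hcont : Continuous fun t => γ t ⬝ᵥ (A *ᵥ γ t) :=
    hγ.dotProduct (continuous_const.matrix_mulVec hγ)
  obtain ⟨t, -, ht⟩ := intermediate_value_Icc (zero_le_one' ℝ) hcont.continuousOn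
    (show (0 : ℝ) ∈ Set.Icc _ _ by simpa [γ] using And.intro hAu hAv)
  by_cases hw : γ t = 0
  · refine ⟨v, hv, ?_⟩
    have ht0 : t ≠ 0 := by
      rintro rfl
      exact hu (by simpa [γ] using hw)
    have hvu : v = (-(1 - t) / t) • u := by
      have h : t • v = -((1 - t) • u) := eq_neg_of_add_eq_zero_right hw
      rw [div_eq_inv_mul, mul_smul, neg_smul, ← h, inv_smul_smul₀ ht0]
    refine le_antisymm ?_ hAv
    rw [hvu, mulVec_smul, smul_dotProduct, dotProduct_smul, smul_eq_mul, smul_eq_mul, ← mul_assoc]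
    exact mul_nonpos_of_nonneg_of_nonpos (mul_self_nonneg _) hAu
  · exact ⟨γ t, hw, ht⟩

/-- If `A` has a nonzero isotropic vector, then some skew-symmetric `Λ` makes `A - Λ` singular. -/
theorem exists_skew_det_sub_eq_zero {ι : Type*} [Fintype ι] [DecidableEq ι] (A : Matrix ι ι ℝ)
    {x : ι → ℝ} (hx : x ≠ 0) (hAx : x ⬝ᵥ (A *ᵥ x) = 0) :
    ∃ Λ : Matrix ι ι ℝ, Λᵀ = -Λ ∧ (A - Λ).det = 0 := by
  refine ⟨(x ⬝ᵥ x)⁻¹ • (vecMulVec (A *ᵥ x) x - vecMulVec x (A *ᵥ x)), ?_, ?_⟩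
  · rw [transpose_smul, transpose_sub, transpose_vecMulVec, transpose_vecMulVec, ← smul_neg,
      neg_sub]
  · refine exists_mulVec_eq_zero_iff.mp ⟨x, hx, ?_⟩
    have hxx : x ⬝ᵥ x ≠ 0 := fun h => hx (dotProduct_self_eq_zero.mp h)
    rw [sub_mulVec, smul_mulVec, sub_mulVec, vecMulVec_mulVec, vecMulVec_mulVec,
      dotProduct_comm (A *ᵥ x) x, hAx]
    simp [smul_smul, hxx]

theorem skew_char_poly_not_sign_definite_of_indefinite (n : ℕ)
    (A : Matrix (Fin n) (Fin n) ℝ) (hA : Aᵀ = A)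
    (hnotpos : ¬ ∀ x : Fin n → ℝ, x ≠ 0 → 0 < x ⬝ᵥ (A *ᵥ x))
    (hnotneg : ¬ ∀ x : Fin n → ℝ, x ≠ 0 → x ⬝ᵥ (A *ᵥ x) < 0) :
    ∃ Λ₁ Λ₂ : Matrix (Fin n) (Fin n) ℝ, Λ₁ᵀ = -Λ₁ ∧ Λ₂ᵀ = -Λ₂ ∧
      (A - Λ₁).det ≤ 0 ∧ 0 ≤ (A - Λ₂).det := by
  push Not at hnotpos hnotneg
  obtain ⟨u, hu, hAu⟩ := hnotpos
  obtain ⟨v, hv, hAv⟩ := hnotneg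
  obtain ⟨x, hx, hAx⟩ := exists_isotropic_of_nonpos_of_nonneg A hu hv hAu hAv
  obtain ⟨Λ, hΛ, hdet⟩ := exists_skew_det_sub_eq_zero A hx hAx
  exact ⟨Λ, Λ, hΛ, hΛ, hdet.le, hdet.ge⟩
end

section
/- Let A be a symmetric real n×n matrix such that det(A − Λ) > 0 for every skew-symmetric real n×n matrix Λ. Then the quadratic form x ↦ xᵀAx is definite, i.e., A is positive definite or negative definite (and negative definiteness can occur only when n is even). -/
open Matrix

/-- A quadratic form taking both a nonpositive and a nonnegative value at nonzero vectors is
isotropic. -/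
lemma exists_isotropic_of_nonpos_of_nonneg_s13 {ι : Type*} [Fintype ι] (A : Matrix ι ι ℝ)
    {x y : ι → ℝ} (hx : x ≠ 0) (hy : y ≠ 0)
    (hqx : x ⬝ᵥ (A *ᵥ x) ≤ 0) (hqy : 0 ≤ y ⬝ᵥ (A *ᵥ y)) :
    ∃ z : ι → ℝ, z ≠ 0 ∧ z ⬝ᵥ (A *ᵥ z) = 0 := by
  let v : ℝ → ι → ℝ := fun t => (1 - t) • x + t • y
  have hcont : Continuous fun t => v t ⬝ᵥ (A *ᵥ v t) := by
    have hv : Continuous v := by fun_prop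
    exact hv.dotProduct (continuous_const.matrix_mulVec hv)
  obtain ⟨t, ht⟩ := mem_range_of_exists_le_of_exists_ge hcont (c := 0)
    ⟨0, by simpa [v] using hqx⟩ ⟨1, by simpa [v] using hqy⟩
  by_cases hvt : v t = 0
  · refine ⟨y, hy, le_antisymm ?_ hqy⟩
    have ht0 : t ≠ 0 := by
      rintro rfl
      exact hx (by simpa [v] using hvt)
    have hyx : y = (-(t⁻¹ * (1 - t))) • x := by
      have h : t • y = -((1 - t) • x) := eq_neg_of_add_eq_zero_right hvt
      rw [neg_smul, mul_smul, ← smul_neg, ← h, inv_smul_smul₀ ht0]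
    rw [hyx, mulVec_smul, smul_dotProduct, dotProduct_smul, smul_eq_mul, smul_eq_mul, ← mul_assoc]
    exact mul_nonpos_of_nonneg_of_nonpos (mul_self_nonneg _) hqx
  · exact ⟨v t, hvt, ht⟩

/-- A vector orthogonal to a nonzero vector `z` is the image of `z` under a skew-symmetric
matrix. -/
lemma exists_skew_mulVec_eq {ι : Type*} [Fintype ι] {z u : ι → ℝ} (hz : z ≠ 0)
    (hzu : z ⬝ᵥ u = 0) : ∃ Λ : Matrix ι ι ℝ, Λᵀ = -Λ ∧ Λ *ᵥ z = u := by
  have hzz : z ⬝ᵥ z ≠ 0 := by simpa using hz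
  refine ⟨(z ⬝ᵥ z)⁻¹ • (vecMulVec u z - vecMulVec z u), ?_, ?_⟩
  · rw [transpose_smul, transpose_sub, transpose_vecMulVec, transpose_vecMulVec, ← smul_neg,
      neg_sub]
  · rw [smul_mulVec, sub_mulVec, vecMulVec_mulVec, vecMulVec_mulVec, dotProduct_comm u z, hzu]
    simp [smul_smul, inv_mul_cancel₀ hzz]

theorem definite_of_skew_char_poly_pos (n : ℕ)
    (A : Matrix (Fin n) (Fin n) ℝ) (hA : Aᵀ = A)
    (hpos : ∀ Λ : Matrix (Fin n) (Fin n) ℝ, Λᵀ = -Λ → 0 < (A - Λ).det) :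
    (∀ x : Fin n → ℝ, x ≠ 0 → 0 < x ⬝ᵥ (A *ᵥ x)) ∨
    ((∀ x : Fin n → ℝ, x ≠ 0 → x ⬝ᵥ (A *ᵥ x) < 0) ∧ Even n) := by
  by_cases hP : ∀ x : Fin n → ℝ, x ≠ 0 → 0 < x ⬝ᵥ (A *ᵥ x)
  · exact Or.inl hP
  push Not at hP
  obtain ⟨x, hx, hqx⟩ := hP
  have hneg : ∀ y : Fin n → ℝ, y ≠ 0 → y ⬝ᵥ (A *ᵥ y) < 0 := by
    intro y hy
    by_contra! hqy
    obtain ⟨z, hz, hqz⟩ := exists_isotropic_of_nonpos_of_nonneg_s13 A hx hy hqx hqy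
    obtain ⟨Λ, hΛ, hΛz⟩ := exists_skew_mulVec_eq hz hqz
    refine (hpos Λ hΛ).ne' (exists_mulVec_eq_zero_iff.mp ⟨z, hz, ?_⟩)
    rw [sub_mulVec, hΛz, sub_self]
  refine Or.inr ⟨hneg, ?_⟩
  have hposDef : (-A).PosDef := by
    refine PosDef.of_dotProduct_mulVec_pos ?_ fun y hy => ?_
    · rw [IsHermitian, conjTranspose_eq_transpose_of_trivial, transpose_neg, hA]
    · simpa [neg_mulVec] using hneg y hy
  have hdet : 0 < A.det := by simpa using hpos 0 (by simp)
  by_contra hn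
  have hdetNeg := hposDef.det_pos
  rw [det_neg, Fintype.card_fin, (Nat.not_even_iff_odd.mp hn).neg_one_pow] at hdetNeg
  linarith
end
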